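/- Let u, v ∈ ℝ² be vectors with u ∧ v = 1, where x ∧ y denotes half the determinant of the 2×2 matrix with columns x and y. Let a, b, c, d be positive reals and set A = v, B = −a·u, C = −b·v, D = u, E = c·u + d·v. If the five points A, B, C, D, E are the vertices of a convex pentagon listed in cyclic order (i.e., they are in convex position in this cyclic order), then the area of the convex hull of {A, B, C, D, E} equals a + b + c + d + a·b. -/

import Mathlib

open MeasureTheory

/-- The outer product of two plane vectors: half the determinant of the matrix with
columns `x` and `y`. -/
noncomputable def wedge (x y : ℝ × ℝ) : ℝ := (x.1 * y.2 - x.2 * y.1) / 2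

/-- `p` lists the vertices of a convex polygon in cyclic order: all consecutive turns
have the same strict orientation (all counterclockwise or all clockwise), so each point
is an extreme point of the hull and the listed cyclic order agrees with the boundary
order. -/
def ConvexPositionCyclic {n : ℕ} [NeZero n] (p : Fin n → ℝ × ℝ) : Prop :=
  (∀ i : Fin n, 0 < wedge (p (i + 1) - p i) (p (i + 2) - p (i + 1))) ∨
    (∀ i : Fin n, wedge (p (i + 1) - p i) (p (i + 2) - p (i + 1)) < 0)

lemma wedge_add_smul (s t s' t' : ℝ) (u v : ℝ × ℝ) :
    wedge (s • u + t • v) (s' • u + t' • v) = (s * t' - t * s') * wedge u v := by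
  simp only [wedge, Prod.fst_add, Prod.snd_add, Prod.smul_fst, Prod.smul_snd, smul_eq_mul]
  ring

/-- Every vector expands in terms of two vectors `p`, `q` by Cramer's rule. -/
lemma wedge_smul_eq (p q x : ℝ × ℝ) :
    wedge p q • x = wedge x q • p + wedge p x • q := by
  ext <;> simp only [wedge, Prod.fst_add, Prod.snd_add, Prod.smul_fst, Prod.smul_snd,
    smul_eq_mul] <;> ring

/-- The closed half-plane to the left of the line directed from `p` to `q`. -/
def leftHalfPlane (p q : ℝ × ℝ) : Set (ℝ × ℝ) :=
  {x | wedge x q + wedge p x ≤ wedge p q}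

lemma convex_leftHalfPlane (p q : ℝ × ℝ) : Convex ℝ (leftHalfPlane p q) := by
  refine convex_halfSpace_le (f := fun x => wedge x q + wedge p x) ⟨?_, ?_⟩ _
  · intro x y
    simp only [wedge, Prod.fst_add, Prod.snd_add]
    ring
  · intro r x
    simp only [wedge, Prod.smul_fst, Prod.smul_snd, smul_eq_mul]
    ring

/-- The triangle with vertices `0`, `p`, `q`, without its edge from `0` to `p`. -/
def halfOpenTriangle (p q : ℝ × ℝ) : Set (ℝ × ℝ) :=
  {x | 0 ≤ wedge x q ∧ 0 < wedge p x ∧ wedge x q + wedge p x ≤ wedge p q}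

lemma measurableSet_halfOpenTriangle (p q : ℝ × ℝ) :
    MeasurableSet (halfOpenTriangle p q) := by
  have h₁ : Measurable fun x : ℝ × ℝ => wedge x q := by unfold wedge; fun_prop
  have h₂ : Measurable fun x : ℝ × ℝ => wedge p x := by unfold wedge; fun_prop
  exact (measurableSet_le measurable_const h₁).inter
    ((measurableSet_lt measurable_const h₂).inter
      (measurableSet_le (h₁.add h₂) measurable_const))

lemma halfOpenTriangle_subset_of_convex {K : Set (ℝ × ℝ)} (hK : Convex ℝ K) {p q : ℝ × ℝ}
    (h0 : 0 ∈ K) (hp : p ∈ K) (hq : q ∈ K) (hpq : 0 < wedge p q) :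
    halfOpenTriangle p q ⊆ K := by
  rintro x ⟨h₁, h₂, h₃⟩
  have hx : x = (1 - wedge x q / wedge p q - wedge p x / wedge p q) • (0 : ℝ × ℝ)
      + (wedge x q / wedge p q) • p + (wedge p x / wedge p q) • q := by
    rw [smul_zero, zero_add, div_eq_inv_mul, div_eq_inv_mul, mul_smul, mul_smul, ← smul_add,
      ← wedge_smul_eq, inv_smul_smul₀ hpq.ne']
  have h₄ : wedge x q / wedge p q + wedge p x / wedge p q ≤ 1 := by
    rw [← add_div]
    exact (div_le_one hpq).2 h₃
  rw [hx]
  have h₅ : 0 ≤ wedge x q / wedge p q := by positivity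
  have h₆ : 0 ≤ wedge p x / wedge p q := by positivity
  have := hK.sum_mem (t := Finset.univ)
    (w := ![1 - wedge x q / wedge p q - wedge p x / wedge p q,
      wedge x q / wedge p q, wedge p x / wedge p q]) (z := ![0, p, q])
    (by intro i _; fin_cases i <;> simp <;> linarith)
    (by simp only [Fin.sum_univ_three, Matrix.cons_val]; ring)
    (by intro i _; fin_cases i <;> simp [h0, hp, hq])
  simpa [Fin.sum_univ_three] using this

lemma volume_halfOpenTriangle_standard :
    volume {x : ℝ × ℝ | 0 ≤ x.1 ∧ 0 < x.2 ∧ x.1 + x.2 ≤ 1} = ENNReal.ofReal (1 / 2) := by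
  have hm : MeasurableSet {x : ℝ × ℝ | 0 ≤ x.1 ∧ 0 < x.2 ∧ x.1 + x.2 ≤ 1} :=
    (measurableSet_le measurable_const measurable_fst).inter
      ((measurableSet_lt measurable_const measurable_snd).inter
        (measurableSet_le (measurable_fst.add measurable_snd) measurable_const))
  have hslice (x : ℝ) :
      volume (Prod.mk x ⁻¹' {x : ℝ × ℝ | 0 ≤ x.1 ∧ 0 < x.2 ∧ x.1 + x.2 ≤ 1}) =
        (Set.Icc (0 : ℝ) 1).indicator (fun x => ENNReal.ofReal (1 - x)) x := by
    by_cases hx : x ∈ Set.Icc (0 : ℝ) 1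
    · rw [Set.indicator_of_mem hx]
      have : Prod.mk x ⁻¹' {x : ℝ × ℝ | 0 ≤ x.1 ∧ 0 < x.2 ∧ x.1 + x.2 ≤ 1} =
          Set.Ioc 0 (1 - x) := by
        ext y
        simp only [Set.mem_preimage, Set.mem_ofPred_eq, Set.mem_Ioc, hx.1, true_and,
          le_sub_iff_add_le']
      rw [this, Real.volume_Ioc, sub_zero]
    · have : Prod.mk x ⁻¹' {x : ℝ × ℝ | 0 ≤ x.1 ∧ 0 < x.2 ∧ x.1 + x.2 ≤ 1} = ∅ :=
        Set.eq_empty_of_forall_notMem fun y ⟨h₁, h₂, h₃⟩ =>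
          hx ⟨h₁, by dsimp only at h₂ h₃; linarith⟩
      rw [Set.indicator_of_notMem hx, this, measure_empty]
  rw [Measure.volume_eq_prod, Measure.prod_apply hm]
  simp_rw [hslice]
  rw [lintegral_indicator measurableSet_Icc, ← ofReal_integral_eq_lintegral_ofReal,
    integral_Icc_eq_integral_Ioc, ← intervalIntegral.integral_of_le zero_le_one]
  · rw [intervalIntegral.integral_sub (by simp) (by simp)]
    norm_num
  · exact (by fun_prop : Continuous fun x : ℝ => 1 - x).continuousOn.integrableOn_Icc
  · filter_upwards [ae_restrict_mem measurableSet_Icc] with x hx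
    exact sub_nonneg.2 hx.2

lemma volume_halfOpenTriangle {p q : ℝ × ℝ} (hpq : 0 < wedge p q) :
    volume (halfOpenTriangle p q) = ENNReal.ofReal (wedge p q) := by
  set D := wedge p q with hD
  set M := Matrix.toLin (Module.Basis.finTwoProd ℝ) (Module.Basis.finTwoProd ℝ)
    !![q.2 / (2 * D), -q.1 / (2 * D); -p.2 / (2 * D), p.1 / (2 * D)] with hM
  have hdet : LinearMap.det M = 1 / (2 * D) := by
    rw [hM, LinearMap.det_toLin, Matrix.det_fin_two_of]
    have : p.1 * q.2 - p.2 * q.1 = 2 * D := by rw [hD, wedge]; ring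
    field_simp
    linarith
  have hMx (x : ℝ × ℝ) : M x = (wedge x q / D, wedge p x / D) := by
    rw [hM, Matrix.toLin_finTwoProd_apply]
    ext <;> simp only [wedge] <;> field_simp <;> ring
  have hpre : halfOpenTriangle p q =
      M ⁻¹' {x : ℝ × ℝ | 0 ≤ x.1 ∧ 0 < x.2 ∧ x.1 + x.2 ≤ 1} := by
    ext x
    simp only [halfOpenTriangle, Set.mem_preimage, Set.mem_ofPred_eq, hMx, ← add_div,
      div_le_one hpq, div_pos_iff_of_pos_right hpq, le_div_iff₀ hpq, zero_mul, ← hD]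
  rw [hpre, Measure.addHaar_preimage_linearMap _ (by rw [hdet]; positivity), hdet,
    volume_halfOpenTriangle_standard, ← ENNReal.ofReal_mul (abs_nonneg _)]
  congr 1
  rw [abs_of_pos (by positivity)]
  field_simp

/-- Area formula for the paper's parametrization of a convex pentagon:
with `u ∧ v = 1`, `A = v`, `B = −a·u`, `C = −b·v`, `D = u`, `E = c·u + d·v` in convex
position in this cyclic order, the area of the pentagon is `a + b + c + d + ab`. -/
theorem pentagon_area_formula (u v : ℝ × ℝ) (huv : wedge u v = 1)
    (a b c d : ℝ) (ha : 0 < a) (hb : 0 < b) (hc : 0 < c) (hd : 0 < d)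
    (A B C D E : ℝ × ℝ)
    (hA : A = v) (hB : B = -a • u) (hC : C = -b • v) (hD : D = u)
    (hE : E = c • u + d • v)
    (hconv : ConvexPositionCyclic ![A, B, C, D, E]) :
    (volume (convexHull ℝ {A, B, C, D, E})).toReal = a + b + c + d + a * b := by
  have hw (s t s' t' : ℝ) : wedge (s • u + t • v) (s' • u + t' • v) = s * t' - t * s' := by
    rw [wedge_add_smul, huv, mul_one]
  replace hA : A = (0 : ℝ) • u + (1 : ℝ) • v := by simp [hA]
  replace hB : B = (-a) • u + (0 : ℝ) • v := by simp [hB]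
  replace hC : C = (0 : ℝ) • u + (-b) • v := by simp [hC]
  replace hD : D = (1 : ℝ) • u + (0 : ℝ) • v := by simp [hD]
  have hsub (s t s' t' : ℝ) :
      (s • u + t • v) - (s' • u + t' • v) = (s - s') • u + (t - t') • v := by module
  obtain ⟨hturnA, hturnD, hturnE⟩ : 0 < c + a * (1 - d) ∧ 0 < d - b * (c - 1) ∧ 0 < c + d - 1 := by
    have hAB : 0 < wedge (B - A) (C - B) := by
      rw [hA, hB, hC, hsub, hsub, hw]
      nlinarith [mul_pos ha hb]
    rcases hconv with h | h
    · have h₂ : 0 < wedge (D - C) (E - D) := h 2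
      have h₃ : 0 < wedge (E - D) (A - E) := h 3
      have h₄ : 0 < wedge (A - E) (B - A) := h 4
      rw [hC, hD, hE, hsub, hsub, hw] at h₂
      rw [hA, hD, hE, hsub, hsub, hw] at h₃
      rw [hA, hB, hE, hsub, hsub, hw] at h₄
      exact ⟨by linarith, by linarith, by linarith⟩
    · exact absurd (h 0) (not_lt.2 hAB.le)
  have hDE : wedge D E = d := by rw [hD, hE, hw]; ring
  have hEA : wedge E A = c := by rw [hE, hA, hw]; ring
  have hAB : wedge A B = a := by rw [hA, hB, hw]; ring
  have hBC : wedge B C = a * b := by rw [hB, hC, hw]; ring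
  have hCD : wedge C D = b := by rw [hC, hD, hw]; ring
  have hab : 0 < a * b := mul_pos ha hb
  have hbc : 0 < b * c := mul_pos hb hc
  have had : 0 < a * d := mul_pos ha hd
  set P := convexHull ℝ {A, B, C, D, E}
  have hPconv : Convex ℝ P := convex_convexHull ℝ _
  have hvert : ({A, B, C, D, E} : Set (ℝ × ℝ)) ⊆ P := subset_convexHull ℝ _
  have hAP : A ∈ P := hvert (by simp)
  have hBP : B ∈ P := hvert (by simp)
  have hCP : C ∈ P := hvert (by simp)
  have hDP : D ∈ P := hvert (by simp)
  have hEP : E ∈ P := hvert (by simp)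
  have h0P : (0 : ℝ × ℝ) ∈ P := by
    have h := hPconv hAP hCP (a := b / (1 + b)) (b := 1 / (1 + b)) (by positivity)
      (by positivity) (by field_simp; ring)
    convert h using 1
    rw [hA, hC]
    match_scalars <;> field_simp <;> ring
  have hedges : P ⊆ leftHalfPlane D E ∩ (leftHalfPlane E A ∩ (leftHalfPlane A B ∩
      (leftHalfPlane B C ∩ leftHalfPlane C D))) := by
    refine convexHull_min ?_ ((convex_leftHalfPlane _ _).inter ((convex_leftHalfPlane _ _).inter
      ((convex_leftHalfPlane _ _).inter ((convex_leftHalfPlane _ _).inter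
        (convex_leftHalfPlane _ _)))))
    rintro x (rfl | rfl | rfl | rfl | rfl) <;>
    simp only [Set.mem_inter_iff, leftHalfPlane, Set.mem_ofPred_eq, hDE, hEA, hAB, hBC, hCD] <;>
    simp only [hA, hB, hC, hD, hE, hw] <;>
    refine ⟨?_, ?_, ?_, ?_, ?_⟩ <;> nlinarith
  have hcoord (x : ℝ × ℝ) : ∃ s t : ℝ, x = s • u + t • v :=
    ⟨wedge x v, wedge u x, by rw [← wedge_smul_eq, huv, one_smul]⟩
  have hmemDE (s t : ℝ) : s • u + t • v ∈ halfOpenTriangle D E ↔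
      0 ≤ s * d - t * c ∧ 0 < t ∧ s • u + t • v ∈ leftHalfPlane D E := by
    refine and_congr ?_ (and_congr ?_ Iff.rfl) <;>
      simp [hD, hE, hw, -zero_smul, -one_smul, -neg_smul]
  have hmemEA (s t : ℝ) : s • u + t • v ∈ halfOpenTriangle E A ↔
      0 ≤ s ∧ s * d - t * c < 0 ∧ s • u + t • v ∈ leftHalfPlane E A := by
    refine and_congr ?_ (and_congr ?_ Iff.rfl) <;>
      simp [hE, hA, hw, -zero_smul, -one_smul, -neg_smul, mul_comm]
  have hmemAB (s t : ℝ) : s • u + t • v ∈ halfOpenTriangle A B ↔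
      0 ≤ t ∧ s < 0 ∧ s • u + t • v ∈ leftHalfPlane A B := by
    refine and_congr ?_ (and_congr ?_ Iff.rfl) <;>
      simp [hA, hB, hw, -zero_smul, -one_smul, -neg_smul, ha]
  have hmemBC (s t : ℝ) : s • u + t • v ∈ halfOpenTriangle B C ↔
      s ≤ 0 ∧ t < 0 ∧ s • u + t • v ∈ leftHalfPlane B C := by
    refine and_congr ?_ (and_congr ?_ Iff.rfl) <;>
      simp [hB, hC, hw, -zero_smul, -one_smul, -neg_smul, mul_nonpos_iff, mul_neg_iff, ha,
        hb.le, ha.not_gt, hb.not_ge]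
  have hmemCD (s t : ℝ) : s • u + t • v ∈ halfOpenTriangle C D ↔
      t ≤ 0 ∧ 0 < s ∧ s • u + t • v ∈ leftHalfPlane C D := by
    refine and_congr ?_ (and_congr ?_ Iff.rfl) <;>
      simp [hC, hD, hw, -zero_smul, -one_smul, -neg_smul, hb]
  have hsubset {p q : ℝ × ℝ} (hp : p ∈ P) (hq : q ∈ P) (hpq : 0 < wedge p q) :
      halfOpenTriangle p q ⊆ P \ {0} :=
    Set.subset_sdiff_singleton (halfOpenTriangle_subset_of_convex hPconv h0P hp hq hpq)
      fun h => by simpa [wedge] using h.2.1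
  have hdiff : P \ {0} = halfOpenTriangle D E ∪ (halfOpenTriangle E A ∪ (halfOpenTriangle A B ∪
      (halfOpenTriangle B C ∪ halfOpenTriangle C D))) := by
    apply Set.Subset.antisymm
    · rintro x ⟨hxP, hx0⟩
      obtain ⟨h₁, h₂, h₃, h₄, h₅⟩ := hedges hxP
      obtain ⟨s, t, rfl⟩ := hcoord x
      have hst : s ≠ 0 ∨ t ≠ 0 := by
        by_contra! h
        exact hx0 (by simp [h.1, h.2])
      simp only [Set.mem_union, hmemDE, hmemEA, hmemAB, hmemBC, hmemCD, h₁, h₂, h₃, h₄, h₅,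
        and_true]
      rcases lt_or_ge s 0 with hs | hs
      · rcases lt_or_ge t 0 with ht | ht
        · exact .inr (.inr (.inr (.inl ⟨hs.le, ht⟩)))
        · exact .inr (.inr (.inl ⟨ht, hs⟩))
      · rcases lt_or_ge 0 t with ht | ht
        · rcases lt_or_ge (s * d - t * c) 0 with h | h
          · exact .inr (.inl ⟨hs, h⟩)
          · exact .inl ⟨h, ht⟩
        · rcases hs.eq_or_lt with rfl | hs
          · exact .inr (.inr (.inr (.inl ⟨le_rfl, ht.lt_of_ne (hst.resolve_left (by simp))⟩)))
          · exact .inr (.inr (.inr (.inr ⟨ht, hs⟩)))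
    · exact Set.union_subset (hsubset hDP hEP (by linarith)) <|
        Set.union_subset (hsubset hEP hAP (by linarith)) <|
        Set.union_subset (hsubset hAP hBP (by linarith)) <|
        Set.union_subset (hsubset hBP hCP (by linarith)) (hsubset hCP hDP (by linarith))
  have hneg {s t : ℝ} (hs : s < 0) (h : 0 ≤ s * d - t * c) (ht : 0 < t) : False := by
    nlinarith [mul_pos ht hc, mul_neg_of_neg_of_pos hs hd]
  have hpos {s t : ℝ} (hs : 0 ≤ s) (h : s * d - t * c < 0) (ht : t ≤ 0) : False := by
    nlinarith [mul_nonneg hs hd.le, mul_nonneg (neg_nonneg.2 ht) hc.le]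
  have hdisj₁ : Disjoint (halfOpenTriangle D E) (halfOpenTriangle E A ∪ (halfOpenTriangle A B ∪
      (halfOpenTriangle B C ∪ halfOpenTriangle C D))) := by
    refine Set.disjoint_left.2 fun x => ?_
    obtain ⟨s, t, rfl⟩ := hcoord x
    simp only [Set.mem_union, hmemDE, hmemEA, hmemAB, hmemBC, hmemCD]
    rintro ⟨h₁, h₂, -⟩ (⟨h₃, h₄, -⟩ | ⟨h₃, h₄, -⟩ | ⟨h₃, h₄, -⟩ | ⟨h₃, h₄, -⟩)
    exacts [by linarith, hneg h₄ h₁ h₂, by linarith, by linarith]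
  have hdisj₂ : Disjoint (halfOpenTriangle E A) (halfOpenTriangle A B ∪
      (halfOpenTriangle B C ∪ halfOpenTriangle C D)) := by
    refine Set.disjoint_left.2 fun x => ?_
    obtain ⟨s, t, rfl⟩ := hcoord x
    simp only [Set.mem_union, hmemEA, hmemAB, hmemBC, hmemCD]
    rintro ⟨h₁, h₂, -⟩ (⟨h₃, h₄, -⟩ | ⟨h₃, h₄, -⟩ | ⟨h₃, h₄, -⟩)
    exacts [by linarith, hpos h₁ h₂ h₄.le, hpos h₁ h₂ h₃]
  have hdisj₃ : Disjoint (halfOpenTriangle A B)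
      (halfOpenTriangle B C ∪ halfOpenTriangle C D) := by
    refine Set.disjoint_left.2 fun x => ?_
    obtain ⟨s, t, rfl⟩ := hcoord x
    simp only [Set.mem_union, hmemAB, hmemBC, hmemCD]
    rintro ⟨h₁, h₂, -⟩ (⟨h₃, h₄, -⟩ | ⟨h₃, h₄, -⟩) <;> linarith
  have hdisj₄ : Disjoint (halfOpenTriangle B C) (halfOpenTriangle C D) := by
    refine Set.disjoint_left.2 fun x => ?_
    obtain ⟨s, t, rfl⟩ := hcoord x
    simp only [hmemBC, hmemCD]
    rintro ⟨h₁, h₂, -⟩ ⟨h₃, h₄, -⟩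
    linarith
  have hmeas := measurableSet_halfOpenTriangle
  have hvol : volume P = ENNReal.ofReal (d + (c + (a + (a * b + b)))) := by
    rw [← measure_sdiff_null (measure_singleton (0 : ℝ × ℝ)), hdiff,
      measure_union hdisj₁ ((hmeas _ _).union ((hmeas _ _).union ((hmeas _ _).union (hmeas _ _)))),
      measure_union hdisj₂ ((hmeas _ _).union ((hmeas _ _).union (hmeas _ _))),
      measure_union hdisj₃ ((hmeas _ _).union (hmeas _ _)), measure_union hdisj₄ (hmeas _ _),
      volume_halfOpenTriangle (by linarith), volume_halfOpenTriangle (by linarith),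
      volume_halfOpenTriangle (by linarith), volume_halfOpenTriangle (by linarith),
      volume_halfOpenTriangle (by linarith), hDE, hEA, hAB, hBC, hCD,
      ENNReal.ofReal_add (by positivity) (by positivity),
      ENNReal.ofReal_add (by positivity) (by positivity),
      ENNReal.ofReal_add (by positivity) (by positivity),
      ENNReal.ofReal_add (by positivity) (by positivity)]
  rw [hvol, ENNReal.toReal_ofReal (by positivity)]
  ring
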